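/- arXiv:math/0304204 — 7 statements merged into one kernel-verified Lean document; each statement's English description precedes it below -/
import Mathlib

section
/- Let L be a separably closed field of characteristic p > 0. Then the set L^{p^∞} := ⋂_{n∈ℕ} L^{p^n} (where L^{p^n} = {x^{p^n} : x ∈ L}) is a subfield of L which is an algebraically closed field, and moreover it contains every algebraically closed subfield of L (i.e. it is the biggest algebraically closed subfield of L). -/
lemma aux_perfect (L : Type*) [Field L] (p : ℕ) [Fact p.Prime] [CharP L p] (F : Type*) [Field F]
    [PerfectField F] (i : F →+* L) (x : F) (n : ℕ) : ∃ y : L, y ^ p ^ n = i x := by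
  haveI : CharP F p := i.charP i.injective p
  haveI : ExpChar F p := ExpChar.prime Fact.out
  haveI : PerfectRing F p := PerfectField.toPerfectRing p
  obtain ⟨y, hy⟩ := (bijective_iterateFrobenius F p n).2 x
  refine ⟨i y, ?_⟩
  rw [← hy, iterateFrobenius_def, map_pow]

/-- In a separably closed field `L` of characteristic `p > 0`, the set
`L^{p^∞} = ⋂ n, L^{p^n}` is a subfield of `L` which is algebraically closed, and it
contains every algebraically closed subfield of `L`. -/
theorem stmt0 (L : Type*) [Field L] (p : ℕ) [Fact p.Prime] [CharP L p] [IsSepClosed L] :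
    ∃ K : Subfield L,
      ((K : Set L) = ⋂ n : ℕ, Set.range (fun x : L => x ^ p ^ n)) ∧
      (∀ f : Polynomial K, 0 < f.degree → ∃ x : K, f.IsRoot x) ∧
      (∀ K' : Subfield L, (∀ f : Polynomial K', 0 < f.degree → ∃ x : K', f.IsRoot x) →
        (K' : Set L) ⊆ (K : Set L)) := by
  haveI : ExpChar L p := ExpChar.prime Fact.out
  obtain ⟨K, hK⟩ : ∃ K : Subfield L, ∀ x, x ∈ K ↔ ∀ n : ℕ, ∃ y : L, y ^ p ^ n = x := by
    refine ⟨⨅ n : ℕ, (iterateFrobenius L p n).fieldRange, fun x => ?_⟩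
    simp [Subfield.mem_iInf, RingHom.mem_fieldRange, iterateFrobenius_def]
  refine ⟨K, ?_, ?_, ?_⟩
  · ext x
    simp [hK]
  · haveI : CharP K p := K.subtype.charP K.subtype.injective p
    haveI : ExpChar K p := ExpChar.prime Fact.out
    haveI : PerfectRing K p := by
      refine PerfectRing.ofSurjective K p fun x => ?_
      obtain ⟨y, hy⟩ := (hK x).1 x.2 1
      rw [pow_one] at hy
      refine ⟨⟨y, (hK y).2 fun n => ?_⟩, Subtype.ext (by simpa [frobenius_def] using hy)⟩
      obtain ⟨z, hz⟩ := (hK x).1 x.2 (n + 1)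
      refine ⟨z, frobenius_inj L p ?_⟩
      rw [frobenius_def, frobenius_def, hy, ← hz, ← pow_mul, pow_succ]
    haveI : PerfectField K := PerfectRing.toPerfectField K p
    haveI : IsAlgClosed K := by
      refine IsAlgClosed.of_exists_root K fun f hm hi => ?_
      obtain ⟨x, hx⟩ := IsSepClosed.exists_aeval_eq_zero L f hi.degree_pos.ne'
        (PerfectField.separable_of_irreducible hi)
      have hint : IsIntegral K x := ⟨f, hm, hx⟩
      haveI : Algebra.IsAlgebraic K (IntermediateField.adjoin K {x}) :=
        IntermediateField.isAlgebraic_adjoin_simple hint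
      haveI : PerfectField (IntermediateField.adjoin K {x}) :=
        Algebra.IsAlgebraic.perfectField K
      have hxK : x ∈ K := (hK x).2 fun n =>
        aux_perfect L p (IntermediateField.adjoin K {x})
          (algebraMap (IntermediateField.adjoin K {x}) L)
          (IntermediateField.AdjoinSimple.gen K x) n
      refine ⟨⟨x, hxK⟩, K.subtype.injective ?_⟩
      have h2 := Polynomial.aeval_algebraMap_apply L (⟨x, hxK⟩ : K) f
      rw [Polynomial.coe_aeval_eq_eval] at h2
      rw [map_zero, ← hx]
      exact h2.symm
    intro f hf
    exact IsAlgClosed.exists_root f hf.ne'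
  · intro K' h x hx
    haveI : IsAlgClosed K' := IsAlgClosed.of_exists_root K' fun f _ hi => h f hi.degree_pos
    exact (hK x).2 fun n => aux_perfect L p K' K'.subtype ⟨x, hx⟩ n
end

section
/- Let L be an algebraically closed field. Call a subset of L^m constructible if it lies in the Boolean algebra of subsets of L^m generated by the zero sets {x ∈ L^m : f(x) = 0} of polynomials f ∈ L[X_1,…,X_m]. Then for every constructible subset S ⊆ L^{n+1}, the image of S under the projection L^{n+1} → L^n forgetting the last coordinate is a constructible subset of L^n. -/
/-- A subset of `L^m` is constructible if it belongs to the smallest collection of subsets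
containing the zero sets of polynomials and closed under finite unions, finite
intersections, and complements. -/
inductive IsPolyConstructible (L : Type*) [CommRing L] (m : ℕ) : Set (Fin m → L) → Prop
  | zeroSet (f : MvPolynomial (Fin m) L) :
      IsPolyConstructible L m {x | MvPolynomial.eval x f = 0}
  | union {s t : Set (Fin m → L)} :
      IsPolyConstructible L m s → IsPolyConstructible L m t → IsPolyConstructible L m (s ∪ t)
  | inter {s t : Set (Fin m → L)} :
      IsPolyConstructible L m s → IsPolyConstructible L m t → IsPolyConstructible L m (s ∩ t)
  | compl {s : Set (Fin m → L)} :
      IsPolyConstructible L m s → IsPolyConstructible L m sᶜ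

/-- The closed point of the spectrum attached to a point of affine space. -/
noncomputable def closedPt {L : Type*} [Field L] {m : ℕ} (x : Fin m → L) :
    PrimeSpectrum (MvPolynomial (Fin m) L) :=
  ⟨RingHom.ker (MvPolynomial.eval x), RingHom.ker_isPrime _⟩

theorem mem_closedPt {L : Type*} [Field L] {m : ℕ} (x : Fin m → L)
    (p : MvPolynomial (Fin m) L) :
    p ∈ (closedPt x).asIdeal ↔ MvPolynomial.eval x p = 0 := Iff.rfl

theorem IsPolyConstructible.exists_spec {L : Type*} [Field L] {m : ℕ} {S : Set (Fin m → L)}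
    (hS : IsPolyConstructible L m S) :
    ∃ T : Set (PrimeSpectrum (MvPolynomial (Fin m) L)),
      Topology.IsConstructible T ∧ S = closedPt ⁻¹' T := by
  induction hS with
  | zeroSet f =>
    refine ⟨(PrimeSpectrum.basicOpen f : Set _)ᶜ,
      Topology.isConstructible_compl.mpr PrimeSpectrum.isConstructible_basicOpen, ?_⟩
    ext x
    simp [mem_closedPt]
  | union _ _ h1 h2 =>
    obtain ⟨T, hT, rfl⟩ := h1
    obtain ⟨U, hU, rfl⟩ := h2
    exact ⟨T ∪ U, hT.union hU, rfl⟩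
  | inter _ _ h1 h2 =>
    obtain ⟨T, hT, rfl⟩ := h1
    obtain ⟨U, hU, rfl⟩ := h2
    exact ⟨T ∩ U, hT.inter hU, rfl⟩
  | compl _ h1 =>
    obtain ⟨T, hT, rfl⟩ := h1
    exact ⟨Tᶜ, Topology.isConstructible_compl.mpr hT, rfl⟩

theorem isPolyConstructible_univ (L : Type*) [CommRing L] (m : ℕ) :
    IsPolyConstructible L m Set.univ := by
  simpa using IsPolyConstructible.zeroSet (L := L) (m := m) 0

theorem isPolyConstructible_preimage {L : Type*} [Field L] {m : ℕ}
    {T : Set (PrimeSpectrum (MvPolynomial (Fin m) L))} (hT : Topology.IsConstructible T) :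
    IsPolyConstructible L m (closedPt ⁻¹' T) := by
  classical
  obtain ⟨D, rfl⟩ := PrimeSpectrum.exists_constructibleSetData_iff.mpr hT
  clear hT
  induction D using Finset.induction_on with
  | empty =>
    simpa [PrimeSpectrum.ConstructibleSetData.toSet] using (isPolyConstructible_univ L m).compl
  | insert C D _ ih =>
    have hC : IsPolyConstructible L m (closedPt ⁻¹' C.toSet) := by
      have key : ∀ s : Finset (Fin C.n),
          IsPolyConstructible L m {x | ∀ i ∈ s, MvPolynomial.eval x (C.g i) = 0} := by
        intro s
        induction s using Finset.induction_on with
        | empty => simpa using isPolyConstructible_univ L m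
        | insert a s _ ihs =>
          have := (IsPolyConstructible.zeroSet (L := L) (m := m) (C.g a)).inter ihs
          convert this using 1
          ext x
          simp
      have := (key Finset.univ).inter (IsPolyConstructible.zeroSet (L := L) (m := m) C.f).compl
      convert this using 1
      ext x
      simp [PrimeSpectrum.BasicConstructibleSetData.toSet, PrimeSpectrum.mem_zeroLocus,
        Set.range_subset_iff, mem_closedPt]
    have := hC.union ih
    convert this using 1
    simp [PrimeSpectrum.ConstructibleSetData.toSet]

theorem image_init_eq {L : Type*} [Field L] [IsAlgClosed L] (n : ℕ)
    {T : Set (PrimeSpectrum (MvPolynomial (Fin (n + 1)) L))} (hT : Topology.IsConstructible T) :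
    (Fin.init '' (closedPt ⁻¹' T) : Set (Fin n → L)) =
      closedPt ⁻¹' (PrimeSpectrum.comap
        (MvPolynomial.rename (R := L) (Fin.castSucc (n := n))).toRingHom '' T) := by
  obtain ⟨D, rfl⟩ := PrimeSpectrum.exists_constructibleSetData_iff.mpr hT
  ext x
  constructor
  · rintro ⟨y, hy, rfl⟩
    refine ⟨closedPt y, hy, ?_⟩
    ext p
    simp only [PrimeSpectrum.comap_asIdeal, Ideal.mem_comap, mem_closedPt]
    simp only [AlgHom.toRingHom_eq_coe, RingHom.coe_coe, MvPolynomial.eval_rename]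
    rfl
  · rintro ⟨P, hP, hx⟩
    simp only [PrimeSpectrum.ConstructibleSetData.toSet, Set.mem_iUnion] at hP
    obtain ⟨C, hCD, hg, hf⟩ := hP
    rw [PrimeSpectrum.mem_zeroLocus, Set.range_subset_iff] at hg
    rw [PrimeSpectrum.mem_zeroLocus, Set.singleton_subset_iff] at hf
    have hP := P.isPrime
    have hn : C.f ∉ P.asIdeal := hf
    rw [← MvPolynomial.IsPrime.vanishingIdeal_zeroLocus (K := L) P.asIdeal,
      MvPolynomial.mem_vanishingIdeal_iff] at hn
    push Not at hn
    obtain ⟨y, hy, hfy⟩ := hn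
    rw [MvPolynomial.mem_zeroLocus_iff] at hy
    simp only [MvPolynomial.aeval_eq_eval] at hy hfy
    refine ⟨y, ?_, ?_⟩
    · simp only [PrimeSpectrum.ConstructibleSetData.toSet, Set.mem_preimage, Set.mem_iUnion]
      refine ⟨C, hCD, ?_, ?_⟩
      · rw [PrimeSpectrum.mem_zeroLocus, Set.range_subset_iff]
        exact fun i => hy _ (hg i)
      · rw [PrimeSpectrum.mem_zeroLocus, Set.singleton_subset_iff]
        exact hfy
    · funext i
      have h1 : (MvPolynomial.X i - MvPolynomial.C (x i) : MvPolynomial (Fin n) L) ∈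
          (closedPt x).asIdeal := by simp [mem_closedPt]
      rw [← hx, PrimeSpectrum.comap_asIdeal, Ideal.mem_comap] at h1
      have h2 := hy _ h1
      simpa [sub_eq_zero, Fin.init] using h2

theorem rename_finitePresentation (L : Type*) [Field L] (n : ℕ) :
    (MvPolynomial.rename (R := L) (Fin.castSucc (n := n))).toRingHom.FinitePresentation := by
  rw [← RingHom.FinitePresentation.of_finiteType]
  refine RingHom.FiniteType.of_comp_finiteType (f := MvPolynomial.C) ?_
  have : ((MvPolynomial.rename (R := L) (Fin.castSucc (n := n))).toRingHom.comp
      MvPolynomial.C) = algebraMap L (MvPolynomial (Fin (n + 1)) L) := by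
    ext; simp
  rw [this, RingHom.finiteType_algebraMap]
  infer_instance

/-- Over an algebraically closed field `L`, the image of a constructible
subset of `L^{n+1}` under the projection to `L^n` forgetting the last coordinate is
constructible (quantifier elimination for algebraically closed fields). -/
theorem stmt6 (L : Type*) [Field L] [IsAlgClosed L] (n : ℕ)
    (S : Set (Fin (n + 1) → L)) (hS : IsPolyConstructible L (n + 1) S) :
    IsPolyConstructible L n (Fin.init '' S) := by
  obtain ⟨T, hT, rfl⟩ := hS.exists_spec
  rw [image_init_eq n hT]
  exact isPolyConstructible_preimage
    (PrimeSpectrum.isConstructible_comap_image (rename_finitePresentation L n) hT)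
end

section
/- Let K be a field of characteristic 0 equipped with a derivation δ, and suppose K is differentially closed: for any two nonconstant differential polynomials f(X), g(X) ∈ K_δ[X] with the order of g strictly less than the order of f, there exists z ∈ K with f(z) = 0 and g(z) ≠ 0. Then the field of constants Cons(K) = {a ∈ K : δ(a) = 0} is a subfield of K which is an algebraically closed field, i.e. every nonconstant polynomial with coefficients in Cons(K) has a root in Cons(K). -/
/-- Let `K` be a differentially closed field of characteristic `0` with
derivation `δ`.  Differential polynomials in one variable are elements of
`K[X_0, X_1, X_2, …]`, evaluated at `z` by substituting `δ^[k] z` for `X_k`; the order of a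
nonconstant differential polynomial `f` is the largest `k` with `X_k` occurring in `f`
(here `f.vars.max`).  If for all nonconstant `f, g` with `order g < order f` there is `z`
with `f(z) = 0 ∧ g(z) ≠ 0`, then the field of constants `{a : δ a = 0}` is a subfield of
`K` which is algebraically closed. -/
theorem stmt7 (K : Type*) [Field K] [CharZero K] (δ : K → K)
    (hδadd : ∀ x y : K, δ (x + y) = δ x + δ y)
    (hδmul : ∀ x y : K, δ (x * y) = x * δ y + y * δ x)
    (hDC : ∀ f g : MvPolynomial ℕ K,
      f ∉ Set.range (MvPolynomial.C : K → MvPolynomial ℕ K) →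
      g ∉ Set.range (MvPolynomial.C : K → MvPolynomial ℕ K) →
      g.vars.max < f.vars.max →
      ∃ z : K, MvPolynomial.eval (fun k => δ^[k] z) f = 0 ∧
        MvPolynomial.eval (fun k => δ^[k] z) g ≠ 0) :
    ∃ F : Subfield K, ((F : Set K) = {a : K | δ a = 0}) ∧
      ∀ q : Polynomial F, 0 < q.degree → ∃ x : F, q.IsRoot x := by
  have h0 : δ 0 = 0 := by simpa using hδadd 0 0
  have h1 : δ 1 = 0 := by simpa using hδmul 1 1
  have hneg : ∀ x, δ (-x) = -δ x := by
    intro x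
    have h := hδadd x (-x)
    rw [add_neg_cancel, h0] at h
    linear_combination -h
  let F : Subfield K :=
    { carrier := {a : K | δ a = 0}
      mul_mem' := by
        intro a b ha hb
        simp only [Set.mem_ofPred_eq] at *
        rw [hδmul, ha, hb]; simp
      one_mem' := h1
      add_mem' := by
        intro a b ha hb
        simp only [Set.mem_ofPred_eq] at *
        rw [hδadd, ha, hb]; simp
      zero_mem' := h0
      neg_mem' := by
        intro a ha
        simp only [Set.mem_ofPred_eq] at *
        rw [hneg, ha]; simp
      inv_mem' := by
        intro a ha
        simp only [Set.mem_ofPred_eq] at *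
        by_cases h : a = 0
        · rw [h, inv_zero, h0]
        · have h2 := hδmul a a⁻¹
          rw [mul_inv_cancel₀ h, h1, ha, mul_zero, add_zero] at h2
          exact (mul_eq_zero.mp h2.symm).resolve_left h }
  have hF : ∀ a : F, δ (a : K) = 0 := fun a => a.2
  refine ⟨F, rfl, ?_⟩
  intro q hq
  let L : K →ₗ[F] K :=
    { toFun := δ
      map_add' := hδadd
      map_smul' := by
        intro a x
        simp only [Subfield.smul_def, smul_eq_mul, RingHom.id_apply]
        rw [hδmul, hF]; simp }
  let D : Derivation F K K := Derivation.mk' L (fun a b => by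
    exact hδmul a b)
  have hD : ∀ x, D x = δ x := fun x => rfl
  -- a root in `K`
  have hroot : ∃ y : K, Polynomial.aeval y q = 0 := by
    let f : MvPolynomial ℕ K := Polynomial.aeval (MvPolynomial.X 1 : MvPolynomial ℕ K) q
    have hev : ∀ v : ℕ → K, MvPolynomial.eval v f = Polynomial.aeval (v 1) q := by
      intro v
      have h := Polynomial.aeval_algHom_apply
        ((MvPolynomial.aeval v : MvPolynomial ℕ K →ₐ[K] K).restrictScalars F)
        (MvPolynomial.X 1) q
      simp only [AlgHom.coe_restrictScalars', MvPolynomial.aeval_X] at h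
      rw [h, MvPolynomial.aeval_eq_eval]
    have hmem : 1 ∈ f.vars := by
      by_contra hn
      have hconst : ∀ t : K, Polynomial.aeval t q = Polynomial.aeval (0 : K) q := by
        intro t
        have h := MvPolynomial.eval₂Hom_congr' (f₁ := RingHom.id K) (f₂ := RingHom.id K)
          (g₁ := fun _ => t) (g₂ := fun i => if i = 1 then 0 else t) (p₁ := f) (p₂ := f) rfl
          (by
            intro i hi _
            have : i ≠ 1 := by rintro rfl; exact hn hi
            simp [this]) rfl
        have e1 := hev (fun _ => t)
        have e2 := hev (fun i => if i = 1 then 0 else t)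
        simp only [if_true] at e2
        rw [← e1, ← e2]
        exact h
      have hz : q.map (algebraMap F K) = Polynomial.C (Polynomial.aeval (0 : K) q) := by
        apply Polynomial.funext
        intro t
        rw [Polynomial.eval_map_algebraMap, hconst t, Polynomial.eval_C]
      have hd := congrArg Polynomial.degree hz
      rw [Polynomial.degree_map] at hd
      have := Polynomial.degree_C_le (a := Polynomial.aeval (0 : K) q)
      rw [← hd] at this
      exact absurd hq (not_lt.mpr this)
    obtain ⟨z, hz, -⟩ := hDC f (MvPolynomial.X 0)
      (by rintro ⟨c, hc⟩; rw [← hc, MvPolynomial.vars_C] at hmem; simp at hmem)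
      (by
        rintro ⟨c, hc⟩
        have := congrArg MvPolynomial.vars hc
        rw [MvPolynomial.vars_C, MvPolynomial.vars_X] at this
        simp at this)
      (by
        rw [MvPolynomial.vars_X, Finset.max_singleton]
        refine lt_of_lt_of_le ?_ (Finset.le_max hmem)
        exact WithBot.coe_lt_coe.mpr Nat.zero_lt_one)
    rw [hev] at hz
    exact ⟨_, hz⟩
  obtain ⟨y, hy⟩ := hroot
  have hq0 : q ≠ 0 := by rintro rfl; simp at hq
  have hint : IsIntegral F y := IsAlgebraic.isIntegral ⟨q, hq0, hy⟩
  have hsep : (minpoly F y).Separable := (minpoly.irreducible hint).separable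
  have hne := hsep.aeval_derivative_ne_zero (minpoly.aeval F y)
  have hder := D.map_aeval (minpoly F y) y
  rw [minpoly.aeval, map_zero, smul_eq_mul] at hder
  have hDy : δ y = 0 := (mul_eq_zero.mp hder.symm).resolve_left hne
  refine ⟨⟨y, hDy⟩, ?_⟩
  have h3 : Polynomial.aeval (algebraMap F K ⟨y, hDy⟩) q = 0 := hy
  rw [Polynomial.aeval_algebraMap_apply] at h3
  simpa using h3
end

section
/- Let K be a field of characteristic 0 with a derivation δ, let P = K[X_{i,k} : 1 ≤ i ≤ n, k ∈ ℕ] be the polynomial ring in the displayed countable family of variables, and let D be the (unique) derivation on P extending δ on K and satisfying D(X_{i,k}) = X_{i,k+1} for all i, k. Then the radical differential ideals of P satisfy the ascending chain condition: there is no strictly increasing infinite chain I_0 ⊊ I_1 ⊊ I_2 ⊊ ⋯ of ideals of P that are both radical and stable under D (equivalently, the δ-closed sets form the closed sets of a Noetherian topology). -/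
namespace RittRaud

open MvPolynomial

/-- A derivation of a commutative ring. -/
structure Der (R : Type*) [CommRing R] where
  /-- the underlying function -/
  toFun : R → R
  map_add' : ∀ x y, toFun (x + y) = toFun x + toFun y
  leibniz' : ∀ x y, toFun (x * y) = x * toFun y + y * toFun x

instance {R : Type*} [CommRing R] : CoeFun (Der R) fun _ => R → R := ⟨Der.toFun⟩

lemma Der.map_add {R : Type*} [CommRing R] (D : Der R) (x y : R) : D (x + y) = D x + D y :=
  D.map_add' x y

lemma Der.leibniz {R : Type*} [CommRing R] (D : Der R) (x y : R) :
    D (x * y) = x * D y + y * D x :=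
  D.leibniz' x y

lemma Der.map_zero {R : Type*} [CommRing R] (D : Der R) : D 0 = 0 := by
  have := D.map_add 0 0
  simpa using this

lemma Der.map_one {R : Type*} [CommRing R] (D : Der R) : D 1 = 0 := by
  have := D.leibniz 1 1
  simpa using this

section basic

variable {R : Type*} [CommRing R] (D : Der R)

/-- Radical differential ideals. -/
def IsRD (I : Ideal R) : Prop := I.IsRadical ∧ ∀ f ∈ I, D f ∈ I

/-- `I` is finitely generated as a radical differential ideal. -/
def FG (I : Ideal R) : Prop :=
  ∃ s : Finset R, (∀ x ∈ s, x ∈ I) ∧ ∀ K : Ideal R, IsRD D K → (∀ x ∈ s, x ∈ K) → I ≤ K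

/-- The basis property. -/
def Basis : Prop := ∀ I : Ideal R, IsRD D I → FG D I

/-- The radical differential ideal generated by a set. -/
def rd (Z : Set R) : Ideal R := sInf {K | IsRD D K ∧ Z ⊆ K}

variable {D}

lemma mem_rd {Z : Set R} {x : R} :
    x ∈ rd D Z ↔ ∀ K : Ideal R, IsRD D K → Z ⊆ K → x ∈ K := by
  simp only [rd, Submodule.mem_sInf, Set.mem_ofPred_eq, and_imp]

lemma subset_rd (Z : Set R) : Z ⊆ rd D Z := fun _ hx => mem_rd.2 fun _ _ h => h hx

lemma rd_le {Z : Set R} {K : Ideal R} (hK : IsRD D K) (h : Z ⊆ K) : rd D Z ≤ K :=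
  fun _ hx => mem_rd.1 hx K hK h

lemma isRD_rd (Z : Set R) : IsRD D (rd D Z) := by
  constructor
  · intro x ⟨n, hn⟩
    exact mem_rd.2 fun K hK h => hK.1 ⟨n, mem_rd.1 hn K hK h⟩
  · intro x hx
    exact mem_rd.2 fun K hK h => hK.2 _ (mem_rd.1 hx K hK h)

lemma IsRD.inf {I J : Ideal R} (hI : IsRD D I) (hJ : IsRD D J) : IsRD D (I ⊓ J) :=
  ⟨fun _ ⟨n, hn⟩ => ⟨hI.1 ⟨n, hn.1⟩, hJ.1 ⟨n, hn.2⟩⟩,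
    fun x hx => ⟨hI.2 x hx.1, hJ.2 x hx.2⟩⟩

lemma IsRD.mul_deriv {K : Ideal R} (hK : IsRD D K) {a b : R} (h : a * b ∈ K) :
    a * D b ∈ K := by
  apply hK.1
  refine ⟨2, ?_⟩
  have h1 := hK.2 _ h
  rw [D.leibniz] at h1
  have h2 : (a * D b) ^ 2 = (a * D b) * (a * D b + b * D a) - (D b * D a) * (a * b) := by ring
  rw [h2]
  exact K.sub_mem (K.mul_mem_left _ h1) (K.mul_mem_left _ h)

/-- The colon ideal. -/
def col (K : Ideal R) (a : R) : Ideal R where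
  carrier := {x | a * x ∈ K}
  add_mem' := by
    intro x y hx hy
    simp only [Set.mem_ofPred_eq, mul_add] at *
    exact K.add_mem hx hy
  zero_mem' := by simp
  smul_mem' := by
    intro c x hx
    simp only [Set.mem_ofPred_eq, smul_eq_mul] at *
    rw [mul_left_comm]
    exact K.mul_mem_left _ hx

lemma mem_col {K : Ideal R} {a x : R} : x ∈ col K a ↔ a * x ∈ K := Iff.rfl

lemma IsRD.pow_mul {K : Ideal R} (hK : IsRD D K) {a x : R} {k : ℕ} (h : a ^ k * x ∈ K) :
    a * x ∈ K := by
  apply hK.1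
  refine ⟨k + 1, ?_⟩
  have : (a * x) ^ (k + 1) = (a * x ^ k) * (a ^ k * x) := by ring
  rw [this]
  exact K.mul_mem_left _ h

lemma IsRD.col {K : Ideal R} (hK : IsRD D K) (a : R) : IsRD D (col K a) := by
  constructor
  · intro x ⟨n, hn⟩
    rw [mem_col, mul_comm] at hn
    rw [mem_col, mul_comm]
    exact hK.pow_mul hn
  · intro x hx
    exact hK.mul_deriv hx

lemma rd_mul_rd {K : Ideal R} (hK : IsRD D K) {Y Z : Set R}
    (h : ∀ y ∈ Y, ∀ z ∈ Z, y * z ∈ K) {y z : R} (hy : y ∈ rd D Y) (hz : z ∈ rd D Z) :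
    y * z ∈ K := by
  have h1 : ∀ y ∈ Y, z ∈ RittRaud.col K y := fun y hy => rd_le (hK.col y) (fun z hz => h y hy z hz) hz
  have h2 : y ∈ RittRaud.col K z := rd_le (hK.col z) (fun y hy => by
    have := h1 y hy
    rw [mem_col] at this
    rw [SetLike.mem_coe, mem_col, mul_comm]; exact this) hy
  rw [mul_comm]; exact h2

lemma rd_mono {Y Z : Set R} (h : Y ⊆ Z) : rd D Y ≤ rd D Z :=
  rd_le (isRD_rd _) (h.trans (subset_rd _))

open Classical in
/-- The union of `rd F` over finite `F ⊆ Z`. -/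
def finrd (D : Der R) (Z : Set R) : Ideal R where
  carrier := {x | ∃ F : Finset R, (F : Set R) ⊆ Z ∧ x ∈ rd D (F : Set R)}
  add_mem' := by
    rintro x y ⟨F, hF, hx⟩ ⟨G, hG, hy⟩
    refine ⟨F ∪ G, by simp [hF, hG], ?_⟩
    exact Ideal.add_mem _ (rd_mono (by simp) hx) (rd_mono (by simp) hy)
  zero_mem' := ⟨∅, by simp, Ideal.zero_mem _⟩
  smul_mem' := by
    rintro c x ⟨F, hF, hx⟩
    exact ⟨F, hF, Ideal.mul_mem_left _ _ hx⟩

lemma rd_finite {Z : Set R} {x : R} (hx : x ∈ rd D Z) :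
    ∃ F : Finset R, (F : Set R) ⊆ Z ∧ x ∈ rd D (F : Set R) := by
  have h : IsRD D (finrd D Z) := by
    constructor
    · rintro x ⟨n, F, hF, hn⟩
      exact ⟨F, hF, (isRD_rd _).1 ⟨n, hn⟩⟩
    · rintro x ⟨F, hF, hn⟩
      exact ⟨F, hF, (isRD_rd _).2 _ hn⟩
  exact rd_le h (fun z hz => ⟨{z}, by simpa using hz, subset_rd _ (by simp)⟩) hx

open Classical in
lemma rd_finset {Z : Set R} (s : Finset R) (hs : ∀ x ∈ s, x ∈ rd D Z) :
    ∃ F : Finset R, (F : Set R) ⊆ Z ∧ ∀ x ∈ s, x ∈ rd D (F : Set R) := by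
  induction s using Finset.induction_on with
  | empty => exact ⟨∅, by simp, by simp⟩
  | insert a s _ ih =>
    obtain ⟨F, hF, h1⟩ := ih fun x hx => hs x (Finset.mem_insert_of_mem hx)
    obtain ⟨G, hG, h2⟩ := rd_finite (hs a (Finset.mem_insert_self _ _))
    refine ⟨F ∪ G, by simp [hF, hG], ?_⟩
    intro x hx
    rcases Finset.mem_insert.1 hx with rfl | hx
    · exact rd_mono (by simp) h2
    · exact rd_mono (by simp) (h1 x hx)

lemma finset_in_chain (c : Set (Ideal R)) (hc : IsChain (· ≤ ·) c) (hne : c.Nonempty)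
    (s : Finset R) (hs : ∀ x ∈ s, x ∈ sSup c) : ∃ I ∈ c, ∀ x ∈ s, x ∈ I := by
  classical
  induction s using Finset.induction_on with
  | empty => obtain ⟨I, hI⟩ := hne; exact ⟨I, hI, by simp⟩
  | insert a s _ ih =>
    obtain ⟨I, hI, h1⟩ := ih fun x hx => hs x (Finset.mem_insert_of_mem hx)
    obtain ⟨J, hJ, h2⟩ := (Submodule.mem_sSup_of_directed hne hc.directedOn).1
      (hs a (Finset.mem_insert_self _ _))
    rcases hc.total hI hJ with h | h
    · refine ⟨J, hJ, ?_⟩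
      intro x hx
      rcases Finset.mem_insert.1 hx with rfl | hx
      · exact h2
      · exact h (h1 x hx)
    · refine ⟨I, hI, ?_⟩
      intro x hx
      rcases Finset.mem_insert.1 hx with rfl | hx
      · exact h h2
      · exact (h1 x hx)

lemma isRD_sSup (c : Set (Ideal R)) (hc : IsChain (· ≤ ·) c) (hne : c.Nonempty)
    (h : ∀ I ∈ c, IsRD D I) : IsRD D (sSup c) := by
  constructor
  · rintro x ⟨n, hn⟩
    obtain ⟨J, hJ, h2⟩ := (Submodule.mem_sSup_of_directed hne hc.directedOn).1 hn
    exact le_sSup hJ ((h J hJ).1 ⟨n, h2⟩)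
  · intro x hn
    obtain ⟨J, hJ, h2⟩ := (Submodule.mem_sSup_of_directed hne hc.directedOn).1 hn
    exact le_sSup hJ ((h J hJ).2 _ h2)

/-- If the basis property fails there is a maximal counterexample. -/
lemma exists_max (h : ¬ Basis D) : ∃ I : Ideal R, IsRD D I ∧ ¬ FG D I ∧
    ∀ J : Ideal R, IsRD D J → I ≤ J → ¬ FG D J → J = I := by
  simp only [Basis, not_forall] at h
  obtain ⟨I0, hI0, hF0⟩ := h
  obtain ⟨m, -, hm⟩ := zorn_le_nonempty₀ {I : Ideal R | IsRD D I ∧ ¬ FG D I} (by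
    intro c hcs hc y hy
    refine ⟨sSup c, ⟨isRD_sSup c hc ⟨y, hy⟩ fun I hI => (hcs hI).1, ?_⟩, fun z hz => le_sSup hz⟩
    rintro ⟨s, hs, hg⟩
    obtain ⟨I, hI, h1⟩ := finset_in_chain c hc ⟨y, hy⟩ s hs
    exact (hcs hI).2 ⟨s, h1, fun K hK h => (le_sSup hI).trans (hg K hK h)⟩) I0 ⟨hI0, hF0⟩
  exact ⟨m, hm.prop.1, hm.prop.2, fun J hJ h1 h2 => le_antisymm (hm.le_of_ge ⟨hJ, h2⟩ h1) h1⟩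

lemma fg_of_larger {I : Ideal R} 
    (hmax : ∀ J : Ideal R, IsRD D J → I ≤ J → ¬ FG D J → J = I) {a : R} (ha : a ∉ I) :
    FG D (rd D (insert a (I : Set R))) := by
  by_contra h
  have h1 := hmax _ (isRD_rd _) ((Set.subset_insert a (I : Set R)).trans (subset_rd _)) h
  apply ha
  rw [← h1]
  exact subset_rd _ (Set.mem_insert _ _)

open Classical in
lemma prime_of_max {I : Ideal R} (hI : IsRD D I) (hF : ¬ FG D I)
    (hmax : ∀ J : Ideal R, IsRD D J → I ≤ J → ¬ FG D J → J = I) {a b : R} (hab : a * b ∈ I) :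
    a ∈ I ∨ b ∈ I := by
  by_contra hcon
  rw [not_or] at hcon
  obtain ⟨s, hs, hs'⟩ := fg_of_larger hmax hcon.1
  obtain ⟨t, ht, ht'⟩ := fg_of_larger hmax hcon.2
  apply hF
  refine ⟨(s ×ˢ t).image fun x => x.1 * x.2, ?_, ?_⟩
  · intro x hx
    simp only [Finset.mem_image, Finset.mem_product] at hx
    obtain ⟨⟨u, v⟩, ⟨hu, hv⟩, rfl⟩ := hx
    refine rd_mul_rd hI ?_ (hs u hu) (ht v hv)
    rintro y (rfl | hy) z (rfl | hz)
    · exact hab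
    · exact I.mul_mem_left _ hz
    · exact I.mul_mem_right _ hy
    · exact I.mul_mem_right _ hy
  · intro K hK hKs x hx
    have h1 : x ∈ rd D (s : Set R) := hs' _ (isRD_rd _) (fun x hx => subset_rd _ hx)
      (subset_rd _ (Set.mem_insert_of_mem _ hx))
    have h2 : x ∈ rd D (t : Set R) := ht' _ (isRD_rd _) (fun x hx => subset_rd _ hx)
      (subset_rd _ (Set.mem_insert_of_mem _ hx))
    have h3 : x * x ∈ K := rd_mul_rd hK (fun y hy z hz => hKs _ (by
      simp only [Finset.mem_image, Finset.mem_product]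
      exact ⟨(y, z), ⟨hy, hz⟩, rfl⟩)) h1 h2
    exact hK.1 ⟨2, by rwa [pow_two]⟩

open Classical in
/-- The final step: if `H ∉ I` but `H * I` is in the radical differential ideal generated
by finitely many elements of `I`, then `I` is finitely generated. -/
lemma fg_of_mul {I : Ideal R}
    (hmax : ∀ J : Ideal R, IsRD D J → I ≤ J → ¬ FG D J → J = I) {H : R} (hH : H ∉ I)
    (t : Finset R) (ht : ∀ x ∈ t, x ∈ I)
    (hmul : ∀ K, IsRD D K → (∀ x ∈ t, x ∈ K) → ∀ x ∈ I, H * x ∈ K) : FG D I := by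
  obtain ⟨s, hs, hs'⟩ := fg_of_larger hmax hH
  obtain ⟨F, hF, hF'⟩ := rd_finset s hs
  refine ⟨t ∪ F.filter (· ∈ I), ?_, ?_⟩
  · intro x hx
    rcases Finset.mem_union.1 hx with h | h
    · exact ht x h
    · exact (Finset.mem_filter.1 h).2
  · intro K hK hKs x hx
    have h1 : rd D (F : Set R) ≤ col K x := rd_le (hK.col x) (by
      intro z hz
      rw [SetLike.mem_coe, mem_col, mul_comm]
      rcases hF hz with rfl | hzI
      · exact hmul K hK (fun x hx => hKs _ (Finset.mem_union_left _ hx)) x hx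
      · exact K.mul_mem_right _
          (hKs _ (Finset.mem_union_right _ (Finset.mem_filter.2 ⟨hz, hzI⟩))))
    have h2 := hs' (rd D (F : Set R)) (isRD_rd _) hF' (subset_rd _ (Set.mem_insert_of_mem _ hx))
    have h3 : x * x ∈ K := h1 h2
    exact hK.1 ⟨2, by rwa [pow_two]⟩

lemma IsRD.comap {R' : Type*} [CommRing R'] {D' : Der R'} (φ : R →+* R')
    (hφ : ∀ x, φ (D x) = D' (φ x)) {K : Ideal R'} (hK : IsRD D' K) : IsRD D (K.comap φ) := by
  constructor
  · rintro x ⟨n, hn⟩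
    rw [Ideal.mem_comap, map_pow] at hn
    exact hK.1 ⟨n, hn⟩
  · intro x hx
    rw [Ideal.mem_comap, hφ]
    exact hK.2 _ hx

open Classical in
lemma Basis.of_surjective {R' : Type*} [CommRing R'] {D' : Der R'} (φ : R →+* R')
    (hφ : ∀ x, φ (D x) = D' (φ x)) (hs : Function.Surjective φ) (h : Basis D) : Basis D' := by
  intro I hI
  obtain ⟨s, hs1, hs2⟩ := h _ (hI.comap φ hφ)
  refine ⟨s.image φ, ?_, ?_⟩
  · intro x hx
    obtain ⟨y, hy, rfl⟩ := Finset.mem_image.1 hx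
    exact hs1 y hy
  · intro K hK hKs x hx
    obtain ⟨y, rfl⟩ := hs x
    exact hs2 _ (hK.comap φ hφ) (fun x hx => hKs _ (Finset.mem_image_of_mem _ hx)) hx

lemma Basis.no_chain (h : Basis D) (I : ℕ → Ideal R) (hI : ∀ m, IsRD D (I m))
    (hlt : ∀ m, I m < I (m + 1)) : False := by
  have hmono : StrictMono I := strictMono_nat_of_lt_succ hlt
  have hc : IsChain (· ≤ ·) (Set.range I) := hmono.monotone.isChain_range
  have hne := Set.range_nonempty I
  obtain ⟨s, hs, hs'⟩ := h _ (isRD_sSup (D := D) _ hc hne (by rintro _ ⟨m, rfl⟩; exact hI m))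
  obtain ⟨_, ⟨m, rfl⟩, hm⟩ := finset_in_chain _ hc hne s hs
  have h1 := hs' _ (hI m) hm
  exact absurd ((le_sSup (Set.mem_range_self (m + 1))).trans h1) (not_le_of_gt (hlt m))

end basic

section construct

variable {A : Type*} [CommRing A]

/-- The ring homomorphism to dual numbers encoding a derivation. -/
noncomputable def dualHom {σ : Type*} (D : Der A) (s : σ → σ) :
    MvPolynomial σ A →+* TrivSqZeroExt (MvPolynomial σ A) (MvPolynomial σ A) :=
  eval₂Hom
    { toFun := fun a => TrivSqZeroExt.inl (C a) + TrivSqZeroExt.inr (C (D a))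
      map_one' := by ext <;> simp [D.map_one]
      map_zero' := by ext <;> simp [D.map_zero]
      map_add' := by intro x y; ext <;> simp [D.map_add]
      map_mul' := by intro x y; ext <;> simp [D.leibniz, mul_comm] }
    (fun i => TrivSqZeroExt.inl (X i) + TrivSqZeroExt.inr (X (s i)))

lemma dualHom_fst {σ : Type*} (D : Der A) (s : σ → σ) (p : MvPolynomial σ A) :
    (dualHom D s p).fst = p := by
  induction p using MvPolynomial.induction_on with
  | C a => simp [dualHom]
  | add p q hp hq => rw [map_add, TrivSqZeroExt.fst_add, hp, hq]
  | mul_X p i hp =>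
    rw [map_mul, TrivSqZeroExt.fst_mul, hp]
    simp [dualHom]

/-- Existence of derivations on polynomial rings. -/
lemma exists_deriv {σ : Type*} (D : Der A) (s : σ → σ) :
    ∃ D' : Der (MvPolynomial σ A),
      (∀ a, D' (C a) = C (D a)) ∧ ∀ i, D' (X i) = X (s i) := by
  refine ⟨
    { toFun := fun p => (dualHom D s p).snd
      map_add' := by intro p q; simp
      leibniz' := by intro p q; simp [dualHom_fst, mul_comm] }, ?_, ?_⟩
  · intro a
    simp [dualHom]
  · intro a
    simp [dualHom]

end construct

section step

variable {A : Type*} [CommRing A]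

/-- Polynomials in the variables of index `< r`. -/
noncomputable abbrev V (A : Type*) [CommRing A] (r : ℕ) : Subalgebra A (MvPolynomial ℕ A) :=
  supported A (Set.Iio r)

lemma V_mono {r s : ℕ} (h : r ≤ s) : V A r ≤ V A s :=
  Algebra.adjoin_mono (Set.image_mono (Set.Iio_subset_Iio h))

lemma X_mem_V {r k : ℕ} (h : k < r) : (X k : MvPolynomial ℕ A) ∈ V A r :=
  Algebra.subset_adjoin ⟨k, h, rfl⟩

lemma C_mem_V (r : ℕ) (a : A) : (C a : MvPolynomial ℕ A) ∈ V A r :=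
  (V A r).algebraMap_mem a

lemma V_induction {r : ℕ} {P : MvPolynomial ℕ A → Prop} (hC : ∀ a, P (C a))
    (hX : ∀ k < r, P (X k)) (hadd : ∀ p q, p ∈ V A r → q ∈ V A r → P p → P q → P (p + q))
    (hmul : ∀ p q, p ∈ V A r → q ∈ V A r → P p → P q → P (p * q)) {p : MvPolynomial ℕ A}
    (hp : p ∈ V A r) : P p := by
  refine Algebra.adjoin_induction (p := fun x _ => P x) ?_ ?_ ?_ ?_ hp
  · rintro _ ⟨k, hk, rfl⟩
    exact hX k hk
  · exact hC
  · intro x y hx hy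
    exact hadd x y hx hy
  · intro x y hx hy
    exact hmul x y hx hy

lemma exists_mem_V (p : MvPolynomial ℕ A) : ∃ r, p ∈ V A r := by
  induction p using MvPolynomial.induction_on with
  | C a => exact ⟨0, C_mem_V 0 a⟩
  | add p q hp hq =>
    obtain ⟨r, hr⟩ := hp
    obtain ⟨s, hs⟩ := hq
    exact ⟨max r s, add_mem (V_mono (le_max_left _ _) hr) (V_mono (le_max_right _ _) hs)⟩
  | mul_X p i hp =>
    obtain ⟨r, hr⟩ := hp
    exact ⟨max r (i + 1), mul_mem (V_mono (le_max_left _ _) hr)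
      (X_mem_V (by omega))⟩

lemma V_zero {p : MvPolynomial ℕ A} (hp : p ∈ V A 0) : ∃ a, p = C a := by
  refine V_induction (P := fun p => ∃ a, p = C a) (fun a => ⟨a, rfl⟩) (by simp) ?_ ?_ hp
  · rintro _ _ - - ⟨a, rfl⟩ ⟨b, rfl⟩
    exact ⟨a + b, by simp⟩
  · rintro _ _ - - ⟨a, rfl⟩ ⟨b, rfl⟩
    exact ⟨a * b, by simp⟩

lemma pderiv_V {r : ℕ} {p : MvPolynomial ℕ A} (hp : p ∈ V A r) : pderiv r p = 0 := by
  refine V_induction (P := fun p => pderiv r p = 0) (by simp) ?_ ?_ ?_ hp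
  · intro k hk
    exact pderiv_X_of_ne (by omega)
  · intro p q _ _ h1 h2
    simp [h1, h2]
  · intro p q _ _ h1 h2
    simp [h1, h2]

lemma pderiv_mem_V {r s : ℕ} {p : MvPolynomial ℕ A} (hp : p ∈ V A s) : pderiv r p ∈ V A s := by
  refine V_induction (P := fun p => pderiv r p ∈ V A s) (by simp) ?_ ?_ ?_ hp
  · intro k hk
    rw [pderiv_X]
    by_cases h : r = k
    · subst h; simp
    · simp [Ne.symm h]
  · intro p q _ _ h1 h2
    rw [map_add]
    exact add_mem h1 h2
  · intro p q h3 h4 h1 h2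
    rw [Derivation.leibniz]
    exact add_mem (mul_mem h3 h2) (mul_mem h4 h1)

/-- Evaluation of univariate polynomials over `V r` at `X r`. -/
noncomputable abbrev ev (r : ℕ) : Polynomial (V A r) →ₐ[V A r] MvPolynomial ℕ A :=
  Polynomial.aeval (X r)

lemma ev_mem (r : ℕ) (p : Polynomial (V A r)) : ev r p ∈ V A (r + 1) := by
  induction p using Polynomial.induction_on' with
  | add p q hp hq => rw [map_add]; exact add_mem hp hq
  | monomial n a =>
    rw [Polynomial.aeval_monomial]
    exact mul_mem (V_mono (Nat.le_succ r) a.2) (pow_mem (X_mem_V (Nat.lt_succ_self r)) _)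

lemma exists_ev {r : ℕ} {p : MvPolynomial ℕ A} (hp : p ∈ V A (r + 1)) : ∃ q, ev r q = p := by
  refine V_induction (P := fun p => ∃ q, ev r q = p) ?_ ?_ ?_ ?_ hp
  · intro a
    exact ⟨Polynomial.C ⟨C a, C_mem_V r a⟩, by rw [Polynomial.aeval_C]; rfl⟩
  · intro k hk
    by_cases h : k = r
    · subst h
      exact ⟨Polynomial.X, Polynomial.aeval_X _⟩
    · exact ⟨Polynomial.C ⟨X k, X_mem_V (by omega)⟩, by rw [Polynomial.aeval_C]; rfl⟩
  · rintro _ _ - - ⟨a, rfl⟩ ⟨b, rfl⟩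
    exact ⟨a + b, map_add _ _ _⟩
  · rintro _ _ - - ⟨a, rfl⟩ ⟨b, rfl⟩
    exact ⟨a * b, map_mul _ _ _⟩

lemma pderiv_ev (r : ℕ) (p : Polynomial (V A r)) :
    pderiv r (ev r p) = ev r p.derivative := by
  induction p using Polynomial.induction_on' with
  | add p q hp hq => simp only [map_add, hp, hq]
  | monomial n a =>
    rw [Polynomial.derivative_monomial, Polynomial.aeval_monomial, Polynomial.aeval_monomial,
      Derivation.leibniz, Derivation.leibniz_pow, pderiv_X_self]
    have : pderiv r (algebraMap (V A r) (MvPolynomial ℕ A) a) = 0 := pderiv_V a.2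
    rw [this]
    simp
    ring

lemma pderiv_map_C (J : Ideal A) (r : ℕ) {p : MvPolynomial ℕ A}
    (hp : p ∈ J.map (C : A →+* MvPolynomial ℕ A)) :
    pderiv r p ∈ J.map (C : A →+* MvPolynomial ℕ A) := by
  refine Submodule.span_induction (p := fun x _ => pderiv r x ∈ J.map (C : A →+* MvPolynomial ℕ A))
    ?_ ?_ ?_ ?_ hp
  · rintro _ ⟨a, ha, rfl⟩
    simp
  · simp
  · intro x y _ _ hx hy
    rw [map_add]; exact Ideal.add_mem _ hx hy
  · intro a x hx h
    rw [smul_eq_mul, Derivation.leibniz]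
    exact Ideal.add_mem _ (Ideal.mul_mem_left _ _ h) (Ideal.mul_mem_right _ _ hx)

lemma cancel_nat [Algebra ℚ A] (N : Ideal (MvPolynomial ℕ A)) {d : ℕ} {x : MvPolynomial ℕ A}
    (h : x * ((d : MvPolynomial ℕ A) + 1) ∈ N) : x ∈ N := by
  have h2 := Ideal.mul_mem_left _ (algebraMap ℚ (MvPolynomial ℕ A) (1 / ((d : ℚ) + 1))) h
  have h3 : algebraMap ℚ (MvPolynomial ℕ A) (1 / ((d : ℚ) + 1)) * ((d : MvPolynomial ℕ A) + 1)
      = 1 := by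
    have : ((d : MvPolynomial ℕ A) + 1) = algebraMap ℚ (MvPolynomial ℕ A) ((d : ℚ) + 1) := by
      simp
    rw [this, ← map_mul, one_div_mul_cancel (by positivity), map_one]
  rw [mul_comm x, ← mul_assoc, h3, one_mul] at h2
  exact h2

lemma coeff_mem [Algebra ℚ A] (J : Ideal A) (r : ℕ) (d : ℕ) (p : Polynomial (V A r))
    (hd : p.natDegree ≤ d) (hp : ev r p ∈ J.map (C : A →+* MvPolynomial ℕ A)) :
    (p.coeff d : MvPolynomial ℕ A) ∈ J.map (C : A →+* MvPolynomial ℕ A) := by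
  induction d generalizing p with
  | zero =>
    rw [Polynomial.eq_C_of_natDegree_le_zero hd, Polynomial.aeval_C] at hp
    exact hp
  | succ d ih =>
    have h1 := ih p.derivative (p.natDegree_derivative_le.trans (by omega))
      (by rw [← pderiv_ev]; exact pderiv_map_C J r hp)
    rw [Polynomial.coeff_derivative] at h1
    push_cast at h1
    exact cancel_nat _ h1

/-- pseudo-division. -/
lemma pseudo_div {B : Type*} [CommRing B] (p : Polynomial B) (hp : p ≠ 0) (e : ℕ) :
    ∀ q : Polynomial B, q.degree < ((p.natDegree + e : ℕ) : WithBot ℕ) →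
    ∃ (k : ℕ) (u q' : Polynomial B), q'.degree < p.degree ∧
      Polynomial.C p.leadingCoeff ^ k * q = u * p + q' := by
  induction e with
  | zero =>
    intro q hq
    exact ⟨0, 0, q, by rwa [Polynomial.degree_eq_natDegree hp], by simp⟩
  | succ e ih =>
    intro q hq
    have h1 : (Polynomial.C p.leadingCoeff * q -
        Polynomial.C (q.coeff (p.natDegree + e)) * p * Polynomial.X ^ e).degree <
        ((p.natDegree + e : ℕ) : WithBot ℕ) := by
      rw [Polynomial.degree_lt_iff_coeff_zero] at hq ⊢
      intro m hm
      rw [Polynomial.coeff_sub, Polynomial.coeff_C_mul, Polynomial.coeff_mul_X_pow',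
        if_pos (by omega), Polynomial.coeff_C_mul]
      rcases hm.eq_or_lt with rfl | hm
      · rw [Nat.add_sub_cancel, Polynomial.leadingCoeff]; ring
      · rw [hq m (by omega), Polynomial.coeff_eq_zero_of_natDegree_lt (n := m - e) (by omega)]
        simp
    obtain ⟨k, u, q', hq', h2⟩ := ih _ h1
    refine ⟨k + 1, u + Polynomial.C p.leadingCoeff ^ k *
      (Polynomial.C (q.coeff (p.natDegree + e)) * Polynomial.X ^ e), q', hq', ?_⟩
    linear_combination h2

variable {D : Der A} {D' : Der (MvPolynomial ℕ A)}

lemma D_mem_V (hC : ∀ a, D' (C a) = C (D a)) (hX : ∀ i, D' (X i) = X (i + 1)) {r : ℕ}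
    {p : MvPolynomial ℕ A} (hp : p ∈ V A r) : D' p ∈ V A (r + 1) := by
  refine V_induction (P := fun p => D' p ∈ V A (r + 1)) ?_ ?_ ?_ ?_ hp
  · intro a; rw [hC]; exact C_mem_V _ _
  · intro k hk; rw [hX]; exact X_mem_V (by omega)
  · intro p q _ _ h1 h2
    rw [D'.map_add]; exact add_mem h1 h2
  · intro p q h3 h4 h1 h2
    rw [D'.leibniz]
    exact add_mem (mul_mem (V_mono (Nat.le_succ r) h3) h2)
      (mul_mem (V_mono (Nat.le_succ r) h4) h1)

lemma D_lead (hC : ∀ a, D' (C a) = C (D a)) (hX : ∀ i, D' (X i) = X (i + 1)) {r : ℕ}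
    {p : MvPolynomial ℕ A} (hp : p ∈ V A (r + 1)) :
    D' p - pderiv r p * X (r + 1) ∈ V A (r + 1) := by
  refine V_induction (P := fun p => D' p - pderiv r p * X (r + 1) ∈ V A (r + 1)) ?_ ?_ ?_ ?_ hp
  · intro a; rw [hC]; simpa using C_mem_V _ _
  · intro k hk; rw [hX]
    by_cases h : k = r
    · subst h; simp
    · rw [pderiv_X_of_ne h, zero_mul, sub_zero]
      exact X_mem_V (by omega)
  · intro p q _ _ h1 h2
    have : D' (p + q) - pderiv r (p + q) * X (r + 1) = (D' p - pderiv r p * X (r + 1)) +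
      (D' q - pderiv r q * X (r + 1)) := by rw [D'.map_add, map_add]; ring
    rw [this]; exact add_mem h1 h2
  · intro p q h3 h4 h1 h2
    have : D' (p * q) - pderiv r (p * q) * X (r + 1) = q * (D' p - pderiv r p * X (r + 1)) +
      p * (D' q - pderiv r q * X (r + 1)) := by
        rw [D'.leibniz, Derivation.leibniz]; simp only [smul_eq_mul]; ring
    rw [this]; exact add_mem (mul_mem h4 h1) (mul_mem h3 h2)

/-- Higher derivatives of `f`. -/
lemma D_iter (hC : ∀ a, D' (C a) = C (D a)) (hX : ∀ i, D' (X i) = X (i + 1)) {r : ℕ}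
    {f : MvPolynomial ℕ A} (hf : f ∈ V A (r + 1)) {L : Ideal (MvPolynomial ℕ A)}
    (hL : IsRD D' L) (hfL : f ∈ L) (m : ℕ) :
    ∃ v ∈ V A (r + 1 + m), pderiv r f * X (r + 1 + m) + v ∈ L := by
  induction m with
  | zero =>
    refine ⟨_, D_lead hC hX hf, ?_⟩
    simpa using hL.2 f hfL
  | succ m ih =>
    obtain ⟨v, hv, h⟩ := ih
    refine ⟨X (r + 1 + m) * D' (pderiv r f) + D' v, ?_, ?_⟩
    · refine add_mem (mul_mem (X_mem_V (by omega)) ?_) (D_mem_V hC hX hv)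
      exact V_mono (by omega) (D_mem_V hC hX (pderiv_mem_V hf))
    · have h1 := hL.2 _ h
      rw [D'.map_add, D'.leibniz, hX] at h1
      rw [← add_assoc]; exact h1

/-- Reduction to order at most `r`. -/
lemma reduce_order (hC : ∀ a, D' (C a) = C (D a)) (hX : ∀ i, D' (X i) = X (i + 1)) {r : ℕ}
    {f : MvPolynomial ℕ A} (hf : f ∈ V A (r + 1)) {L : Ideal (MvPolynomial ℕ A)}
    (hL : IsRD D' L) (hfL : f ∈ L) (m : ℕ) : ∀ g ∈ V A (r + 1 + m),
    ∃ k : ℕ, ∃ h ∈ V A (r + 1), pderiv r f ^ k * g - h ∈ L := by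
  have hS : pderiv r f ∈ V A (r + 1) := pderiv_mem_V hf
  induction m with
  | zero => 
    intro g hg
    exact ⟨0, g, hg, by simp⟩
  | succ m ih =>
    intro g hg
    refine V_induction (P := fun g => ∃ k : ℕ, ∃ h ∈ V A (r + 1), pderiv r f ^ k * g - h ∈ L)
      ?_ ?_ ?_ ?_ hg
    · intro a
      exact ⟨0, C a, C_mem_V _ _, by simp⟩
    · intro j hj
      by_cases hjm : j = r + 1 + m
      · subst hjm
        obtain ⟨v, hv, h1⟩ := D_iter hC hX hf hL hfL m
        obtain ⟨k, h, hh, h2⟩ := ih v hv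
        refine ⟨k + 1, -h, neg_mem hh, ?_⟩
        have : pderiv r f ^ (k + 1) * X (r + 1 + m) - -h =
          pderiv r f ^ k * (pderiv r f * X (r + 1 + m) + v) - (pderiv r f ^ k * v - h) := by ring
        rw [this]
        exact L.sub_mem (L.mul_mem_left _ h1) h2
      · exact ih _ (X_mem_V (by omega))
    · rintro p q - - ⟨k, h, hh, h1⟩ ⟨l, h', hh', h2⟩
      refine ⟨k + l, pderiv r f ^ l * h + pderiv r f ^ k * h',
        add_mem (mul_mem (pow_mem hS _) hh) (mul_mem (pow_mem hS _) hh'), ?_⟩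
      have : pderiv r f ^ (k + l) * (p + q) - (pderiv r f ^ l * h + pderiv r f ^ k * h') =
        pderiv r f ^ l * (pderiv r f ^ k * p - h) + pderiv r f ^ k * (pderiv r f ^ l * q - h') := by
          ring
      rw [this]
      exact L.add_mem (L.mul_mem_left _ h1) (L.mul_mem_left _ h2)
    · rintro p q - - ⟨k, h, hh, h1⟩ ⟨l, h', hh', h2⟩
      refine ⟨k + l, h * h', mul_mem hh hh', ?_⟩
      have : pderiv r f ^ (k + l) * (p * q) - h * h' =
        (pderiv r f ^ l * q) * (pderiv r f ^ k * p - h) + h * (pderiv r f ^ l * q - h') := by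
          ring
      rw [this]
      exact L.add_mem (L.mul_mem_left _ h1) (L.mul_mem_left _ h2)

open Classical in
theorem Basis.step [Algebra ℚ A] (hC : ∀ a, D' (C a) = C (D a))
    (hX : ∀ i, D' (X i) = X (i + 1)) (hA : Basis D) : Basis D' := by
  by_contra hcon
  obtain ⟨I, hI, hF, hmax⟩ := exists_max hcon
  have hcomap : ∀ K : Ideal (MvPolynomial ℕ A), IsRD D' K → IsRD D (K.comap C) :=
    fun K hK => hK.comap C fun a => (hC a).symm
  obtain ⟨s, hs, hs'⟩ := hA _ (hcomap I hI)
  set N : Ideal (MvPolynomial ℕ A) := (I.comap C).map C with hN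
  have hNI : N ≤ I := Ideal.map_comap_le
  have hNK : ∀ K, IsRD D' K → (∀ x ∈ s, C x ∈ K) → N ≤ K := by
    intro K hK h
    rw [hN, Ideal.map_le_iff_le_comap]
    exact hs' _ (hcomap K hK) h
  have hIN : ¬ I ≤ N := by
    intro h
    apply hF
    refine ⟨s.image C, ?_, ?_⟩
    · intro x hx
      obtain ⟨y, hy, rfl⟩ := Finset.mem_image.1 hx
      exact hs y hy
    · intro K hK hKs
      exact h.trans (hNK K hK fun x hx => hKs _ (Finset.mem_image_of_mem _ hx))
  -- minimal order
  have hex : ∃ r, ∃ f ∈ V A r, f ∈ I ∧ f ∉ N := by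
    obtain ⟨f, hf, hfN⟩ := Set.not_subset.1 hIN
    obtain ⟨r, hr⟩ := exists_mem_V f
    exact ⟨r, f, hr, hf, hfN⟩
  obtain ⟨r, hr, hrmin⟩ : ∃ r, (∃ f ∈ V A (r + 1), f ∈ I ∧ f ∉ N) ∧
      ∀ f ∈ V A r, f ∈ I → f ∈ N := by
    have h1 := Nat.find_spec hex
    have h2 := fun m => Nat.find_min hex (m := m)
    rcases h : Nat.find hex with _ | r
    · rw [h] at h1
      obtain ⟨f, hf, hfI, hfN⟩ := h1
      obtain ⟨a, rfl⟩ := V_zero hf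
      exact absurd (Ideal.mem_map_of_mem C (Ideal.mem_comap.2 hfI)) hfN
    · rw [h] at h1 h2
      refine ⟨r, h1, fun f hf hfI => ?_⟩
      by_contra hfN
      exact h2 r (Nat.lt_succ_self r) ⟨f, hf, hfI, hfN⟩
  -- minimal degree
  have hne : {p : Polynomial (V A r) | ev r p ∈ I ∧ ev r p ∉ N}.Nonempty := by
    obtain ⟨f, hf, hfI, hfN⟩ := hr
    obtain ⟨p, rfl⟩ := exists_ev hf
    exact ⟨p, hfI, hfN⟩
  obtain ⟨p, ⟨hpI, hpN⟩, hpmin'⟩ := Polynomial.degree_lt_wf.has_min _ hne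
  have hpmin : ∀ q : Polynomial (V A r), q.degree < p.degree → ev r q ∈ I → ev r q ∈ N := by
    intro q hq hqI
    by_contra hqN
    exact hpmin' q ⟨hqI, hqN⟩ hq
  have hp0 : p ≠ 0 := by
    rintro rfl
    exact hpN (by simp)
  set c : MvPolynomial ℕ A := (p.leadingCoeff : MvPolynomial ℕ A) with hc
  have hcN : c ∉ N := by
    intro hcN
    have h1 : ev r p = ev r p.eraseLead + c * X r ^ p.natDegree := by
      conv_lhs => rw [← p.eraseLead_add_monomial_natDegree_leadingCoeff]
      rw [map_add, Polynomial.aeval_monomial]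
      rfl
    have h2 : c * X r ^ p.natDegree ∈ N := N.mul_mem_right _ hcN
    have h3 : ev r p.eraseLead ∈ N := hpmin _ (Polynomial.degree_eraseLead_lt hp0) (by
      have : ev r p.eraseLead = ev r p - c * X r ^ p.natDegree := by rw [h1]; ring
      rw [this]
      exact I.sub_mem hpI (hNI h2))
    exact hpN (by rw [h1]; exact N.add_mem h3 h2)
  have hcI : c ∉ I := fun h => hcN (hrmin c p.leadingCoeff.2 h)
  have hSI : pderiv r (ev r p) ∉ I := by
    intro h
    rw [pderiv_ev] at h
    have h1 := hpmin _ (Polynomial.degree_derivative_lt hp0) h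
    rcases hd : p.natDegree with _ | d
    · apply hpN
      apply hrmin _ _ hpI
      rw [Polynomial.eq_C_of_natDegree_eq_zero hd, Polynomial.aeval_C]
      exact (p.coeff 0).2
    · have h2 := coeff_mem _ r d p.derivative (p.natDegree_derivative_le.trans (by omega)) h1
      rw [Polynomial.coeff_derivative, ← hd] at h2
      push_cast at h2
      exact hcN (cancel_nat _ h2)
  have hHI : pderiv r (ev r p) * c ∉ I := by
    intro h
    rcases prime_of_max hI hF hmax h with h | h
    · exact hSI h
    · exact hcI h
  apply hF
  refine fg_of_mul hmax hHI (insert (ev r p) (s.image C)) ?_ ?_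
  · intro x hx
    rcases Finset.mem_insert.1 hx with rfl | hx
    · exact hpI
    · obtain ⟨y, hy, rfl⟩ := Finset.mem_image.1 hx
      exact hs y hy
  · intro K hK hKs g hg
    have hL := hK.inf hI
    set L := K ⊓ I with hLdef
    have hpL : ev r p ∈ L := ⟨hKs _ (Finset.mem_insert_self _ _), hpI⟩
    have hNL : N ≤ L := le_inf (hNK K hK fun x hx =>
      hKs _ (Finset.mem_insert_of_mem (Finset.mem_image_of_mem _ hx))) hNI
    obtain ⟨m, hm⟩ := exists_mem_V g
    obtain ⟨k, h, hh, h1⟩ := reduce_order hC hX (ev_mem r p) hL hpL m g (V_mono (by omega) hm)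
    obtain ⟨q, rfl⟩ := exists_ev hh
    obtain ⟨k', u, q', hq', h2⟩ := pseudo_div p hp0 (q.natDegree + 1) q
      (lt_of_le_of_lt Polynomial.degree_le_natDegree (by
        exact_mod_cast (by omega : q.natDegree < p.natDegree + (q.natDegree + 1))))
    have h3 : c ^ k' * ev r q = ev r u * ev r p + ev r q' := by
      have := congrArg (ev r) h2
      rw [map_add, map_mul, map_mul, map_pow, Polynomial.aeval_C] at this
      exact this
    have hqI : ev r q ∈ I := by
      have : ev r q = pderiv r (ev r p) ^ k * g - (pderiv r (ev r p) ^ k * g - ev r q) := by ring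
      rw [this]
      exact I.sub_mem (I.mul_mem_left _ hg) h1.2
    have hq'I : ev r q' ∈ I := by
      have : ev r q' = c ^ k' * ev r q - ev r u * ev r p := by rw [h3]; ring
      rw [this]
      exact I.sub_mem (I.mul_mem_left _ hqI) (I.mul_mem_left _ hpI)
    have h4 : c ^ k' * (pderiv r (ev r p) ^ k * g) ∈ L := by
      have : c ^ k' * (pderiv r (ev r p) ^ k * g) =
          c ^ k' * (pderiv r (ev r p) ^ k * g - ev r q) + (ev r u * ev r p + ev r q') := by
        rw [← h3]; ring
      rw [this]
      exact L.add_mem (L.mul_mem_left _ h1)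
        (L.add_mem (L.mul_mem_left _ hpL) (hNL (hpmin q' hq' hq'I)))
    have h5 := hL.pow_mul h4
    rw [mul_left_comm] at h5
    have h6 := hL.pow_mul h5
    rw [mul_assoc]
    exact h6.1

end step

section final

lemma Basis.field {K : Type*} [Field K] (D : Der K) : Basis D := by
  intro I _
  rcases Ideal.eq_bot_or_top I with rfl | rfl
  · exact ⟨∅, by simp, fun _ _ _ => bot_le⟩
  · refine ⟨{1}, by simp, fun L _ h => ?_⟩
    rw [top_le_iff, Ideal.eq_top_iff_one]
    exact h 1 (by simp)

lemma Basis.main {K : Type*} [Field K] [CharZero K] (d : Der K) (n : ℕ) :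
    ∀ D : Der (MvPolynomial (Fin n × ℕ) K),
    (∀ a, D (C a) = C (d a)) → (∀ i k, D (X (i, k)) = X (i, k + 1)) → Basis D := by
  induction n with
  | zero =>
    intro D hC _
    exact (Basis.field d).of_surjective C (fun x => (hC x).symm) (C_surjective _)
  | succ n ih =>
    intro D hC hX
    obtain ⟨D1, hC1, hX1⟩ := exists_deriv (σ := Fin n × ℕ) d fun x => (x.1, x.2 + 1)
    obtain ⟨D2, hC2, hX2⟩ := exists_deriv (σ := ℕ) D1 fun x => x + 1
    have h1 : Basis D2 := Basis.step hC2 hX2 (ih D1 hC1 fun i k => hX1 (i, k))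
    let ψ : MvPolynomial (Fin n × ℕ) K →+* MvPolynomial (Fin (n + 1) × ℕ) K :=
      (rename fun x => (x.1.castSucc, x.2)).toRingHom
    have hψC : ∀ a, ψ (C a) = C a := fun a => rename_C _ _
    have hψX : ∀ i k, ψ (X (i, k)) = X (i.castSucc, k) := fun i k => rename_X _ _
    have hψ : ∀ x, ψ (D1 x) = D (ψ x) := by
      intro x
      induction x using MvPolynomial.induction_on with
      | C a => rw [hC1, hψC, hψC, hC]
      | add p q hp hq => simp only [map_add, Der.map_add, hp, hq]
      | mul_X p i hp =>
        obtain ⟨i, k⟩ := i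
        rw [Der.leibniz, map_mul, Der.leibniz, hX1, hψX, hX]
        simp only [map_add, map_mul, hp, hψX]
    let φ : MvPolynomial ℕ (MvPolynomial (Fin n × ℕ) K) →+* MvPolynomial (Fin (n + 1) × ℕ) K :=
      eval₂Hom ψ fun k => X (Fin.last n, k)
    have hφC : ∀ a, φ (C a) = ψ a := fun a => eval₂Hom_C _ _ _
    have hφX : ∀ k, φ (X k) = X (Fin.last n, k) := fun k => eval₂Hom_X' _ _ _
    refine h1.of_surjective φ ?_ ?_
    · intro x
      induction x using MvPolynomial.induction_on with
      | C a => rw [hC2, hφC, hφC, hψ]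
      | add p q hp hq => simp only [map_add, Der.map_add, hp, hq]
      | mul_X p i hp =>
        rw [Der.leibniz, map_mul, Der.leibniz, hX2, hφX, hX]
        simp only [map_add, map_mul, hp, hφX]
    · intro y
      induction y using MvPolynomial.induction_on with
      | C a => exact ⟨C (C a), by rw [hφC, hψC]⟩
      | add p q hp hq =>
        obtain ⟨x, rfl⟩ := hp
        obtain ⟨y, rfl⟩ := hq
        exact ⟨x + y, map_add _ _ _⟩
      | mul_X p i hp =>
        obtain ⟨x, rfl⟩ := hp
        obtain ⟨i, k⟩ := i
        induction i using Fin.lastCases with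
        | last => exact ⟨x * X k, by rw [map_mul, hφX]⟩
        | cast i => exact ⟨x * C (X (i, k)), by rw [map_mul, hφC, hψX]⟩

end final

end RittRaud


/-- Ritt–Raudenbush basis theorem: Let `K` be a field of characteristic `0`
with a derivation `δ`, let `P = K[X_{i,k} : i < n, k ∈ ℕ]`, and let `D : P → P` be the
derivation extending `δ` with `D X_{i,k} = X_{i,k+1}`.  Then there is no strictly
increasing infinite chain of radical differential ideals of `P`. -/
theorem stmt8 (K : Type*) [Field K] [CharZero K] (δ : K → K)
    (hδadd : ∀ x y : K, δ (x + y) = δ x + δ y)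
    (hδmul : ∀ x y : K, δ (x * y) = x * δ y + y * δ x)
    (n : ℕ) (D : MvPolynomial (Fin n × ℕ) K → MvPolynomial (Fin n × ℕ) K)
    (hDadd : ∀ f g, D (f + g) = D f + D g)
    (hDmul : ∀ f g, D (f * g) = f * D g + g * D f)
    (hDC : ∀ c : K, D (MvPolynomial.C c) = MvPolynomial.C (δ c))
    (hDX : ∀ (i : Fin n) (k : ℕ), D (MvPolynomial.X (i, k)) = MvPolynomial.X (i, k + 1)) :
    ¬ ∃ I : ℕ → Ideal (MvPolynomial (Fin n × ℕ) K),
        (∀ m : ℕ, (I m).IsRadical ∧ ∀ f ∈ I m, D f ∈ I m) ∧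
        (∀ m : ℕ, I m < I (m + 1)) := by
  rintro ⟨I, hI, hlt⟩
  let d : RittRaud.Der K := ⟨δ, hδadd, hδmul⟩
  let D' : RittRaud.Der (MvPolynomial (Fin n × ℕ) K) := ⟨D, hDadd, hDmul⟩
  exact (RittRaud.Basis.main d n D' hDC hDX).no_chain I hI hlt
end

section
/- Let L be a field of characteristic p > 0 and let m ≥ 1. Then the polynomial X·Y^{p^m} + Z^{p^m} is irreducible in the polynomial ring L[X, Y, Z]. -/
theorem stmt9 (L : Type*) [Field L] (p : ℕ) [Fact p.Prime] [CharP L p]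
    (m : ℕ) (hm : 1 ≤ m) :
    Irreducible (MvPolynomial.X 0 * MvPolynomial.X 1 ^ p ^ m + MvPolynomial.X 2 ^ p ^ m :
      MvPolynomial (Fin 3) L) := by
  have hv : ∀ i : Fin 3, i ≠ 0 → (0 : Fin 3) ∉
      (MvPolynomial.X i ^ p ^ m : MvPolynomial (Fin 3) L).vars := by
    intro i hi h
    have := MvPolynomial.vars_pow _ _ h
    simp at this
    exact hi this.symm
  rw [mul_comm]
  apply MvPolynomial.irreducible_mul_X_add
  · exact pow_ne_zero _ (MvPolynomial.X_ne_zero _)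
  · exact hv 1 (by decide)
  · exact hv 2 (by decide)
  · apply IsRelPrime.pow
    rw [(MvPolynomial.X_prime (R := L) (i := (1 : Fin 3))).irreducible.isRelPrime_iff_not_dvd]
    rw [MvPolynomial.X_dvd_X]
    decide
end

section
/- Let L be a separably closed field of characteristic p > 0 and let L^{p^∞} := ⋂_{n∈ℕ} L^{p^n}. Then the set G := {x ∈ L^{p^∞} : x ≠ 0} is a subgroup of the multiplicative group L^× which is divisible (for every g ∈ G and every integer m ≥ 1 there is h ∈ G with h^m = g), and G contains every divisible subgroup of L^×; that is, G is the maximal divisible subgroup of the multiplicative group of L, consisting exactly of the infinitely p-divisible elements of L^×. -/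
/-- In a separably closed field `L` of characteristic `p > 0`, the nonzero
elements of `L^{p^∞} = ⋂ n, L^{p^n}` form a divisible subgroup `G` of the multiplicative
group `Lˣ`, and `G` contains every divisible subgroup of `Lˣ`: it is the maximal divisible
subgroup of `Lˣ`, consisting exactly of the infinitely `p`-divisible elements. -/
theorem stmt10 (L : Type*) [Field L] (p : ℕ) [Fact p.Prime] [CharP L p] [IsSepClosed L] :
    ∃ G : Subgroup Lˣ,
      ((G : Set Lˣ) = {u : Lˣ | ∀ n : ℕ, ∃ x : L, x ^ p ^ n = (u : L)}) ∧
      (∀ g ∈ G, ∀ m : ℕ, 1 ≤ m → ∃ h ∈ G, h ^ m = g) ∧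
      (∀ H : Subgroup Lˣ, (∀ g ∈ H, ∀ m : ℕ, 1 ≤ m → ∃ h ∈ H, h ^ m = g) → H ≤ G) := by
  have hp : p.Prime := Fact.out
  have key : ∀ (u : Lˣ) (n : ℕ), (∃ x : L, x ^ p ^ n = (u : L)) ↔ ∃ x : Lˣ, x ^ p ^ n = u := by
    intro u n
    constructor
    · rintro ⟨x, hx⟩
      have hx0 : x ≠ 0 := by
        rintro rfl
        rw [zero_pow (pow_ne_zero _ hp.ne_zero)] at hx
        exact u.ne_zero hx.symm
      exact ⟨Units.mk0 x hx0, Units.ext (by simpa using hx)⟩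
    · rintro ⟨x, rfl⟩
      exact ⟨x, by simp⟩
  have inj : ∀ (k : ℕ) (a b : Lˣ), a ^ p ^ k = b ^ p ^ k → a = b := by
    intro k a b h
    apply Units.ext
    apply iterateFrobenius_inj L p k
    simpa [iterateFrobenius_def] using congrArg (Units.val) h
  let G : Subgroup Lˣ := ⨅ n : ℕ, (powMonoidHom (p ^ n) : Lˣ →* Lˣ).range
  have hG : ∀ u : Lˣ, u ∈ G ↔ ∀ n : ℕ, ∃ x : Lˣ, x ^ p ^ n = u := by
    intro u
    simp [G, Subgroup.mem_iInf, MonoidHom.mem_range]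
  refine ⟨G, ?_, ?_, ?_⟩
  · ext u
    simp only [SetLike.mem_coe, Set.mem_setOf_eq, key, hG]
  · intro g hg m hm
    obtain ⟨k, r, hr, rfl⟩ := Nat.exists_eq_pow_mul_and_not_dvd (n := m) (by omega) p hp.ne_one
    obtain ⟨x, hx⟩ := (hG g).1 hg k
    have hxG : x ∈ G := by
      rw [hG]
      intro n
      obtain ⟨y, hy⟩ := (hG g).1 hg (n + k)
      refine ⟨y, inj k _ _ ?_⟩
      rw [hx, ← hy, ← pow_mul, pow_add]
    haveI : NeZero (r : L) := ⟨fun h => hr ((CharP.cast_eq_zero_iff L p r).1 h)⟩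
    obtain ⟨z, hz⟩ := IsSepClosed.exists_pow_nat_eq (x : L) r
    have hr0 : r ≠ 0 := by rintro rfl; simp at hr
    have hz0 : z ≠ 0 := by
      rintro rfl
      rw [zero_pow hr0] at hz
      exact x.ne_zero hz.symm
    obtain ⟨w, hw⟩ : ∃ w : Lˣ, w ^ r = x := ⟨Units.mk0 z hz0, Units.ext (by simpa using hz)⟩
    refine ⟨w, (hG w).2 fun n => ?_, by rw [mul_comm, pow_mul, hw, hx]⟩
    have hc : Nat.Coprime r (p ^ n) := ((hp.coprime_iff_not_dvd.2 hr).symm).pow_right n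
    have hb := Nat.gcd_eq_gcd_ab r (p ^ n)
    rw [hc.gcd_eq_one] at hb
    obtain ⟨y, hy⟩ := (hG x).1 hxG n
    refine ⟨y ^ (r.gcdA (p ^ n)) * w ^ (r.gcdB (p ^ n)), ?_⟩
    have h1 : w = w ^ ((1 : ℕ) : ℤ) := by simp
    conv_rhs => rw [h1, hb, zpow_add, zpow_mul, zpow_natCast, hw, ← hy]
    rw [mul_pow]
    congr 1
    · rw [← zpow_natCast, ← zpow_natCast, ← zpow_mul, ← zpow_mul, mul_comm]
    · rw [← zpow_natCast, ← zpow_mul, mul_comm]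
  · intro H hH g hg
    rw [hG]
    intro n
    obtain ⟨h, -, e⟩ := hH g hg (p ^ n) (Nat.one_le_pow _ _ hp.pos)
    exact ⟨h, e⟩
end

section
/- Let L be a separably closed field of characteristic p > 0 which is not perfect (L^p ≠ L). Then both L^p = {x^p : x ∈ L} and its complement L ∖ L^p are infinite; consequently L^p is not a constructible subset of the affine line over L, i.e. L^p is not a finite Boolean combination of zero sets of one-variable polynomials over L. -/
/-- A subset of the affine line over `L` is constructible if it belongs to the smallest
collection of subsets of `L` containing the zero sets of one-variable polynomials and
closed under finite unions, finite intersections, and complements. -/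
inductive IsPolyConstructible1 (L : Type*) [CommRing L] : Set L → Prop
  | zeroSet (f : Polynomial L) : IsPolyConstructible1 L {x | Polynomial.eval x f = 0}
  | union {s t : Set L} :
      IsPolyConstructible1 L s → IsPolyConstructible1 L t → IsPolyConstructible1 L (s ∪ t)
  | inter {s t : Set L} :
      IsPolyConstructible1 L s → IsPolyConstructible1 L t → IsPolyConstructible1 L (s ∩ t)
  | compl {s : Set L} : IsPolyConstructible1 L s → IsPolyConstructible1 L sᶜ

theorem IsPolyConstructible1.finite_or {L : Type*} [Field L] {s : Set L}
    (h : IsPolyConstructible1 L s) : s.Finite ∨ sᶜ.Finite := by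
  induction h with
  | zeroSet f =>
    by_cases hf : f = 0
    · right
      simp [hf]
    · left
      classical
      refine (f.roots.toFinset.finite_toSet).subset ?_
      intro x hx
      simpa [hf] using hx
  | @union s t _ _ h1 h2 =>
    rcases h1 with h1 | h1
    · rcases h2 with h2 | h2
      · exact Or.inl (h1.union h2)
      · exact Or.inr (h2.subset (Set.compl_subset_compl.2 Set.subset_union_right))
    · exact Or.inr (h1.subset (Set.compl_subset_compl.2 Set.subset_union_left))
  | @inter s t _ _ h1 h2 =>
    rcases h1 with h1 | h1
    · exact Or.inl (h1.subset Set.inter_subset_left)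
    · rcases h2 with h2 | h2
      · exact Or.inl (h2.subset Set.inter_subset_right)
      · right
        rw [Set.compl_inter]
        exact h1.union h2
  | compl _ h =>
    rw [compl_compl]
    exact h.symm

/-- If `L` is a separably closed field of characteristic `p > 0` which is
not perfect, then both `L^p = {x^p : x ∈ L}` and its complement are infinite; consequently
`L^p` is not a constructible subset of the affine line over `L`. -/
theorem stmt11 (L : Type*) [Field L] (p : ℕ) [Fact p.Prime] [CharP L p] [IsSepClosed L]
    (hperf : ¬ Function.Surjective (fun x : L => x ^ p)) :
    (Set.range (fun x : L => x ^ p)).Infinite ∧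
    (Set.range (fun x : L => x ^ p))ᶜ.Infinite ∧
    ¬ IsPolyConstructible1 L (Set.range (fun x : L => x ^ p)) := by
  have hinj : Function.Injective (fun x : L => x ^ p) := frobenius_inj L p
  have hL : Infinite L := by
    by_contra hfin
    rw [not_infinite_iff_finite] at hfin
    exact hperf (Finite.surjective_of_injective hinj)
  have h1 : (Set.range (fun x : L => x ^ p)).Infinite := Set.infinite_range_of_injective hinj
  have h2 : (Set.range (fun x : L => x ^ p))ᶜ.Infinite := by
    simp only [Function.Surjective, not_forall] at hperf
    obtain ⟨a, ha⟩ := hperf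
    have hinj2 : Function.Injective (fun x : L => a + x ^ p) :=
      fun x y hxy => hinj (add_left_cancel hxy)
    refine (Set.infinite_range_of_injective hinj2).mono ?_
    rintro _ ⟨x, rfl⟩ ⟨y, hy⟩
    refine ha ⟨y - x, ?_⟩
    have hs : (y - x) ^ p = y ^ p - x ^ p := sub_pow_char y x
    simp only at hy ⊢
    rw [hs, hy, add_sub_cancel_right]
  exact ⟨h1, h2, fun h => h.finite_or.elim h1 h2⟩
end
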